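/- There is no nonzero rational number s such that both 2s and s² + 1 are squares of rational numbers. -/

import Mathlib

theorem Int.exists_eq_sq_of_isCoprime_of_pos {m n k : ℤ} (h : IsCoprime m n) (hm : 0 < m)
    (heq : m * n = k ^ 2) : ∃ p : ℤ, m = p ^ 2 := by
  obtain ⟨p, hp | hp⟩ := Int.sq_of_isCoprime h heq
  · exact ⟨p, hp⟩
  · nlinarith [sq_nonneg p]

/-- If twice a product of coprime positive integers, the second one even, is a square, and the sum
of their squares is a square, then they come from a solution of `x ^ 4 + 4 * y ^ 4 = p ^ 2`. -/
theorem exists_pow_four_add_four_mul_pow_four_of_even {r t p q : ℤ} (hrt : IsCoprime r t)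
    (hr : 0 < r) (ht : 0 < t) (hte : Even t) (hq : q ^ 2 = 2 * r * t)
    (hp : p ^ 2 = r ^ 2 + t ^ 2) :
    ∃ x y : ℤ, x ^ 4 + 4 * y ^ 4 = p ^ 2 ∧ q ^ 2 = 4 * (x * y) ^ 2 := by
  obtain ⟨u, rfl⟩ := hte.two_dvd
  have hqe : Even q := by
    have : Even (q ^ 2) := ⟨2 * r * u, by rw [hq]; ring⟩
    exact (Int.even_pow.mp this).1
  obtain ⟨w, rfl⟩ := hqe.two_dvd
  have hu : 0 < u := by linarith
  have hru : IsCoprime r u := hrt.of_mul_right_right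
  have hw : r * u = w ^ 2 := by linarith
  obtain ⟨x, rfl⟩ := Int.exists_eq_sq_of_isCoprime_of_pos hru hr hw
  obtain ⟨y, rfl⟩ := Int.exists_eq_sq_of_isCoprime_of_pos hru.symm hu ((mul_comm _ _).trans hw)
  exact ⟨x, y, by rw [hp]; ring, by rw [hq]; ring⟩

/-- The descent step for `a ^ 4 + 4 * b ^ 4 = c ^ 2`, for a primitive solution with `a` odd. -/
theorem exists_smaller_of_pow_four_add_four_mul_pow_four {a b c : ℤ} (hb : b ≠ 0)
    (hab : IsCoprime a b) (ha : Odd a) (h : a ^ 4 + 4 * b ^ 4 = c ^ 2) :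
    ∃ x y z : ℤ, x * y ≠ 0 ∧ (x * y) ^ 2 < (a * b) ^ 2 ∧ x ^ 4 + 4 * y ^ 4 = z ^ 2 := by
  have ha0 : a ≠ 0 := by rintro rfl; simp at ha
  have hc : 0 < |c| := by
    rw [abs_pos]
    rintro rfl
    have : 0 < a ^ 4 := by positivity
    have : 0 < b ^ 4 := by positivity
    linarith
  have ha2 : IsCoprime a 2 := Int.isCoprime_two_right.mpr ha
  have h₁ : PythagoreanTriple (a ^ 2) (2 * b ^ 2) |c| := by
    unfold PythagoreanTriple
    rw [abs_mul_abs_self]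
    linear_combination h
  obtain ⟨m, n, hm, hn, -, hmn, -, hm0⟩ := h₁.coprime_classification'
    (Int.isCoprime_iff_gcd_eq_one.mp (ha2.pow_left.mul_right hab.pow))
    (Int.odd_iff.mp ha.pow) hc
  rw [← Int.isCoprime_iff_gcd_eq_one] at hmn
  have hmnb : m * n = b ^ 2 := by linarith
  have hb2 : 0 < b ^ 2 := by positivity
  have hn0 : 0 < n := pos_of_mul_pos_right (hmnb ▸ hb2) hm0
  have hm0 : 0 < m := pos_of_mul_pos_left (hmnb ▸ hb2) hn0.le
  obtain ⟨p, rfl⟩ := Int.exists_eq_sq_of_isCoprime_of_pos hmn hm0 hmnb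
  obtain ⟨q, rfl⟩ :=
    Int.exists_eq_sq_of_isCoprime_of_pos hmn.symm hn0 ((mul_comm _ _).trans hmnb)
  have h₂ : PythagoreanTriple a (q ^ 2) (p ^ 2) := by
    unfold PythagoreanTriple
    linear_combination hm
  have haq : IsCoprime a (q ^ 2) :=
    (hab.pow_right (n := 2)).of_isCoprime_of_dvd_right (Dvd.intro_left _ hmnb)
  obtain ⟨r, t, -, hq, hp, hrt, hpar, hr0⟩ := h₂.coprime_classification'
    (Int.isCoprime_iff_gcd_eq_one.mp haq) (Int.odd_iff.mp ha) hm0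
  rw [← Int.isCoprime_iff_gcd_eq_one] at hrt
  have hrt0 : 0 < r * t := by linarith
  have ht0 : 0 < t := pos_of_mul_pos_right hrt0 hr0
  have hr0 : 0 < r := pos_of_mul_pos_left hrt0 ht0.le
  have key : ∃ x y : ℤ, x ^ 4 + 4 * y ^ 4 = p ^ 2 ∧ q ^ 2 = 4 * (x * y) ^ 2 := by
    rcases hpar with ⟨hre, -⟩ | ⟨-, hte⟩
    · exact exists_pow_four_add_four_mul_pow_four_of_even hrt.symm ht0 hr0 (Int.even_iff.mpr hre)
        (by linarith) (by linarith)
    · exact exists_pow_four_add_four_mul_pow_four_of_even hrt hr0 ht0 (Int.even_iff.mpr hte) hq hp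
  obtain ⟨x, y, hxy, hqxy⟩ := key
  have hxy0 : 0 < (x * y) ^ 2 := by linarith
  refine ⟨x, y, p, by rintro h0; simp [h0] at hxy0, ?_, hxy⟩
  have ha1 : 0 < a ^ 2 := by positivity
  calc (x * y) ^ 2 < q ^ 2 := by linarith
    _ ≤ p ^ 2 * q ^ 2 := le_mul_of_one_le_left hn0.le hm0
    _ = b ^ 2 := hmnb
    _ ≤ a ^ 2 * b ^ 2 := le_mul_of_one_le_left hb2.le ha1
    _ = (a * b) ^ 2 := by ring

theorem Int.pow_four_add_four_mul_pow_four_ne_sq {a b : ℤ} (hab : a * b ≠ 0) (c : ℤ) :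
    a ^ 4 + 4 * b ^ 4 ≠ c ^ 2 := by
  induction hk : (a * b).natAbs using Nat.strong_induction_on generalizing a b c with
  | _ k ih =>
  subst hk
  intro h
  have ih' : ∀ x y z : ℤ, x * y ≠ 0 → (x * y) ^ 2 < (a * b) ^ 2 → x ^ 4 + 4 * y ^ 4 ≠ z ^ 2 :=
    fun x y z hxy hlt ↦ ih _ (Int.natAbs_lt_iff_sq_lt.mpr hlt) hxy z rfl
  have hab2 : 0 < (a * b) ^ 2 := by positivity
  rcases Int.even_or_odd a with hae | hao
  · obtain ⟨d, rfl⟩ := hae.two_dvd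
    have hce : Even c := by
      have : Even (c ^ 2) := ⟨8 * d ^ 4 + 2 * b ^ 4, by rw [← h]; ring⟩
      exact (Int.even_pow.mp this).1
    obtain ⟨e, rfl⟩ := hce.two_dvd
    exact ih' b d e (by rintro h0; apply hab; linear_combination 2 * h0)
      (by nlinarith) (by linarith)
  · by_cases hco : IsCoprime a b
    · obtain ⟨x, y, z, hxy, hlt, hz⟩ := exists_smaller_of_pow_four_add_four_mul_pow_four
        (right_ne_zero_of_mul hab) hco hao h
      exact ih' x y z hxy hlt hz
    · rw [Int.isCoprime_iff_gcd_eq_one, ← ne_eq, Nat.ne_one_iff_exists_prime_dvd] at hco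
      obtain ⟨l, hl, hlg⟩ := hco
      obtain ⟨d, rfl⟩ := (Int.natCast_dvd_natCast.mpr hlg).trans (Int.gcd_dvd_left a b)
      obtain ⟨e, rfl⟩ := (Int.natCast_dvd_natCast.mpr hlg).trans (Int.gcd_dvd_right _ b)
      have hl2 : (2 : ℤ) ≤ l := by exact_mod_cast hl.two_le
      have hlc : (l : ℤ) ^ 2 ∣ c := by
        rw [← Int.pow_dvd_pow_iff two_ne_zero, ← h]
        exact ⟨d ^ 4 + 4 * e ^ 4, by ring⟩
      obtain ⟨f, rfl⟩ := hlc
      have hde : d * e ≠ 0 := by rintro h0; apply hab; linear_combination (l : ℤ) ^ 2 * h0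
      refine ih' d e f hde ?_ ?_
      · have : 0 < (d * e) ^ 2 := by positivity
        have : 1 < (l : ℤ) ^ 4 := one_lt_pow₀ (by linarith) (by norm_num)
        nlinarith
      · have : (l : ℤ) ^ 4 ≠ 0 := by positivity
        apply mul_left_cancel₀ this
        linear_combination h

theorem stmt_13 : ¬ ∃ s : ℚ, s ≠ 0 ∧ IsSquare (2 * s) ∧ IsSquare (s ^ 2 + 1) := by
  rintro ⟨s, hs, ⟨u, hu⟩, ⟨v, hv⟩⟩
  have hu0 : u ≠ 0 := by rintro rfl; simp [hs] at hu
  have hsq : IsSquare ((u.num ^ 4 + 4 * (u.den : ℤ) ^ 4 : ℤ) : ℚ) := by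
    refine ⟨2 * v * u.den ^ 2, ?_⟩
    have hnum : (u.num : ℚ) = u * u.den := (Rat.mul_den_eq_num u).symm
    push_cast
    rw [hnum]
    linear_combination (u.den : ℚ) ^ 4 * (4 * hv - (2 * s + u * u) * hu)
  rw [Rat.isSquare_intCast_iff] at hsq
  obtain ⟨c, hc⟩ := hsq
  exact Int.pow_four_add_four_mul_pow_four_ne_sq
    (mul_ne_zero (Rat.num_ne_zero.mpr hu0) (by exact_mod_cast u.den_ne_zero)) c (hc.trans (sq c).symm)
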